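/- Single-block average pattern variance (Appendix C identity): within a single block (m = 0 fixed), the average over starting offsets of the variance of the partial sums satisfies (2/n)·∑_{r=0}^{n−1} Var[∑_{j=0}^{r−1} E_j] = (n + 1)·V / 3, where E_j = e(σ_I(j)) + e(σ_Q(j)) for a single pair of independent uniform random permutations σ_I, σ_Q of Fin n. -/

import Mathlib

open Finset

theorem perm_sum_swap {n : ℕ} (F : Equiv.Perm (Fin n) → ℝ) (i j : Fin n) :
    ∑ σ : Equiv.Perm (Fin n), F (σ * Equiv.swap i j) = ∑ σ : Equiv.Perm (Fin n), F σ :=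
  Equiv.sum_comp (Equiv.mulRight (Equiv.swap i j)) F

theorem perm_sum_one {n : ℕ} (g : Fin n → ℝ) (i : Fin n) :
    (n : ℝ) * ∑ σ : Equiv.Perm (Fin n), g (σ i)
      = (Fintype.card (Equiv.Perm (Fin n)) : ℝ) * ∑ k, g k := by
  have h1 : ∀ j : Fin n, ∑ σ : Equiv.Perm (Fin n), g (σ j)
      = ∑ σ : Equiv.Perm (Fin n), g (σ i) := by
    intro j
    rw [← perm_sum_swap (fun σ => g (σ j)) j i]
    simp
  have h2 : ∑ j : Fin n, ∑ σ : Equiv.Perm (Fin n), g (σ j)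
      = (n : ℝ) * ∑ σ : Equiv.Perm (Fin n), g (σ i) := by
    rw [Finset.sum_congr rfl (fun j _ => h1 j)]
    simp
  rw [← h2, Finset.sum_comm]
  rw [Finset.sum_congr rfl (fun σ _ => Equiv.sum_comp σ g)]
  simp

theorem perm_sum_two {n : ℕ} (f : Fin n → ℝ) (hf : ∑ k, f k = 0) (i j : Fin n) (hij : j ≠ i) :
    ∑ σ : Equiv.Perm (Fin n), f (σ i) ^ 2
      + ((n : ℝ) - 1) * ∑ σ : Equiv.Perm (Fin n), f (σ i) * f (σ j) = 0 := by
  have h1 : ∀ k : Fin n, k ∈ Finset.univ.erase i →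
      ∑ σ : Equiv.Perm (Fin n), f (σ i) * f (σ k)
      = ∑ σ : Equiv.Perm (Fin n), f (σ i) * f (σ j) := by
    intro k hk
    have hk' : k ≠ i := Finset.ne_of_mem_erase hk
    rw [← perm_sum_swap (fun σ => f (σ i) * f (σ k)) k j]
    simp [Equiv.swap_apply_of_ne_of_ne hk'.symm hij.symm]
  have h2 : ∑ k : Fin n, ∑ σ : Equiv.Perm (Fin n), f (σ i) * f (σ k) = 0 := by
    rw [Finset.sum_comm]
    apply Finset.sum_eq_zero
    intro σ _
    rw [← Finset.mul_sum, Equiv.sum_comp σ f, hf, mul_zero]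
  rw [← Finset.add_sum_erase _ _ (Finset.mem_univ i), Finset.sum_congr rfl h1,
    Finset.sum_const, Finset.card_erase_of_mem (Finset.mem_univ i), nsmul_eq_mul] at h2
  have hn : 1 ≤ n := by have := i.2; omega
  simp only [Finset.card_univ, Fintype.card_fin] at h2
  rw [Nat.cast_sub hn] at h2
  simp only [pow_two]
  simpa using h2

theorem perm_var {n : ℕ} (hn : 2 ≤ n) (f : Fin n → ℝ) (hf : ∑ k, f k = 0) (s : Finset (Fin n)) :
    ∑ σ : Equiv.Perm (Fin n), (∑ j ∈ s, f (σ j)) ^ 2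
      = (Fintype.card (Equiv.Perm (Fin n)) : ℝ) * ((∑ k, f k ^ 2) / n)
        * ((#s : ℝ) * (n - #s) / (n - 1)) := by
  have hn' : (2 : ℝ) ≤ n := by exact_mod_cast hn
  have hn0 : (n : ℝ) ≠ 0 := by linarith
  have hn1 : (n : ℝ) - 1 ≠ 0 := by linarith
  set A : ℝ := (Fintype.card (Equiv.Perm (Fin n)) : ℝ) * ((∑ k, f k ^ 2) / n) with hA
  have hAi : ∀ i : Fin n, ∑ σ : Equiv.Perm (Fin n), f (σ i) ^ 2 = A := by
    intro i
    have := perm_sum_one (fun k => f k ^ 2) i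
    rw [hA]
    field_simp
    linarith
  have hC : ∀ i j : Fin n, ∑ σ : Equiv.Perm (Fin n), f (σ i) * f (σ j)
      = -A / (n - 1) + if i = j then A + A / (n - 1) else 0 := by
    intro i j
    by_cases h : i = j
    · subst h
      have := hAi i
      simp only [pow_two] at this
      rw [this, if_pos rfl]; ring
    · have := perm_sum_two f hf i j (Ne.symm h)
      rw [hAi] at this
      rw [if_neg h]
      field_simp
      linarith
  have h1 : ∑ σ : Equiv.Perm (Fin n), (∑ j ∈ s, f (σ j)) ^ 2
      = ∑ i ∈ s, ∑ j ∈ s, ∑ σ : Equiv.Perm (Fin n), f (σ i) * f (σ j) := by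
    simp only [pow_two, Finset.sum_mul_sum]
    rw [Finset.sum_comm]
    refine Finset.sum_congr rfl fun i _ => ?_
    rw [Finset.sum_comm]
  rw [h1]
  simp only [hC, Finset.sum_add_distrib, Finset.sum_const, nsmul_eq_mul, Finset.sum_ite_eq]
  rw [Finset.sum_congr rfl (fun i hi => if_pos hi)]
  simp only [Finset.sum_const, nsmul_eq_mul]
  field_simp
  ring

theorem sum_parabola (n : ℕ) (x : ℝ) :
    ∑ r ∈ Finset.range n, (r : ℝ) * (x - r)
      = x * (n * (n - 1) / 2) - (n - 1) * n * (2 * n - 1) / 6 := by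
  induction n with
  | zero => simp
  | succ k ih => rw [Finset.sum_range_succ, ih]; push_cast; ring

/-- **Single-block average pattern variance (Appendix C identity).**
For a single block built from two independent uniform random permutations
`σ_I, σ_Q` of `Fin n` (modelled as a uniformly random pair `p` of permutations),
with symbol energies `E_j = e(σ_I(j)) + e(σ_Q(j))`, the average over starting
offsets `r` of the variance of the partial sums `∑_{j<r} E_j` satisfies
`(2/n) ∑_{r<n} Var[∑_{j<r} E_j] = (n+1) V / 3`.
Expectations are averages over all pairs of permutations. -/
theorem ccdm_single_block_average_pattern_variance
    (n : ℕ) (hn : 2 ≤ n) (e : Fin n → ℝ)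
    (m₂ m₄ μ₂ μ₄ V : ℝ)
    (hm₂ : m₂ = (∑ k, e k) / n) (hm₄ : m₄ = (∑ k, (e k) ^ 2) / n)
    (hμ₂ : μ₂ = 2 * m₂) (hμ₄ : μ₄ = 2 * m₄ + 2 * m₂ ^ 2) (hV : V = μ₄ - μ₂ ^ 2)
    (Np : ℝ)
    (hNp : Np = (Fintype.card (Equiv.Perm (Fin n) × Equiv.Perm (Fin n)) : ℝ))
    (E : Fin n → Equiv.Perm (Fin n) × Equiv.Perm (Fin n) → ℝ)
    (hE : ∀ j p, E j p = e (p.1 j) + e (p.2 j))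
    (Sp : ℕ → Equiv.Perm (Fin n) × Equiv.Perm (Fin n) → ℝ)
    (hSp : ∀ r p, Sp r p = ∑ j : Fin n, if (j : ℕ) < r then E j p else 0)
    (Var : ℕ → ℝ)
    (hVar : ∀ r, Var r = (∑ p : Equiv.Perm (Fin n) × Equiv.Perm (Fin n),
        (Sp r p - (∑ q : Equiv.Perm (Fin n) × Equiv.Perm (Fin n), Sp r q) / Np) ^ 2) / Np) :
    (2 / (n : ℝ)) * ∑ r ∈ Finset.range n, Var r = ((n : ℝ) + 1) * V / 3 := by
  have hn' : (2 : ℝ) ≤ n := by exact_mod_cast hn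
  have hn0 : (n : ℝ) ≠ 0 := by linarith
  have hn1 : (n : ℝ) - 1 ≠ 0 := by linarith
  set M : ℝ := (Fintype.card (Equiv.Perm (Fin n)) : ℝ) with hM
  have hM0 : M ≠ 0 := by rw [hM]; exact_mod_cast Fintype.card_ne_zero
  have hNM : Np = M * M := by rw [hNp, Fintype.card_prod]; push_cast; rfl
  set f : Fin n → ℝ := fun k => e k - m₂ with hfdef
  have hf : ∑ k, f k = 0 := by
    simp only [hfdef, Finset.sum_sub_distrib, Finset.sum_const, Finset.card_univ,
      Fintype.card_fin, nsmul_eq_mul, hm₂]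
    field_simp
    ring
  have hes : ∑ k, e k = n * m₂ := by rw [hm₂]; field_simp
  have hes2 : ∑ k, e k ^ 2 = n * m₄ := by rw [hm₄]; field_simp
  have hf2 : (∑ k, f k ^ 2) / n = m₄ - m₂ ^ 2 := by
    have : ∑ k, f k ^ 2 = ∑ k, e k ^ 2 - 2 * m₂ * ∑ k, e k + n * m₂ ^ 2 := by
      have h : ∀ k, f k ^ 2 = e k ^ 2 - 2 * m₂ * e k + m₂ ^ 2 := by
        intro k; simp only [hfdef]; ring
      simp only [h, Finset.sum_add_distrib, Finset.sum_sub_distrib, ← Finset.mul_sum]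
      simp
    rw [this, hes, hes2]
    field_simp
    ring
  have hV2 : V = 2 * (m₄ - m₂ ^ 2) := by rw [hV, hμ₄, hμ₂]; ring
  have hvar : ∀ r ∈ Finset.range n, Var r = V / (n - 1) * ((r : ℝ) * (n - r)) := by
    intro r hr
    have hrn : r < n := Finset.mem_range.mp hr
    set s : Finset (Fin n) := Finset.univ.filter (fun j : Fin n => (j : ℕ) < r) with hs
    have hcard : #s = r := by
      rw [hs, Fin.card_filter_val_lt]; omega
    set T : Equiv.Perm (Fin n) → ℝ := fun σ => ∑ j ∈ s, f (σ j) with hT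
    have hS : ∀ p, Sp r p = T p.1 + T p.2 + 2 * r * m₂ := by
      intro p
      rw [hSp, ← Finset.sum_filter, ← hs]
      simp only [hE, hT, hfdef, Finset.sum_sub_distrib, Finset.sum_add_distrib,
        Finset.sum_const, nsmul_eq_mul, hcard]
      ring
    have hT0 : ∑ σ, T σ = 0 := by
      simp only [hT]
      rw [Finset.sum_comm]
      refine Finset.sum_eq_zero fun i _ => ?_
      have := perm_sum_one f i
      rw [hf, mul_zero] at this
      exact (mul_eq_zero.mp this).resolve_left hn0
    have hT2 : ∑ σ, T σ ^ 2 = M * (m₄ - m₂ ^ 2) * ((r : ℝ) * (n - r) / (n - 1)) := by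
      have := perm_var hn f hf s
      rw [hcard, hf2] at this
      exact this
    have hmean : (∑ q, Sp r q) / Np = 2 * r * m₂ := by
      simp only [hS, Fintype.sum_prod_type, Finset.sum_add_distrib, hT0, Finset.sum_const,
        Finset.card_univ, nsmul_eq_mul, ← Finset.mul_sum, Fintype.card_prod, Nat.cast_mul, ← hM, hNM]
      field_simp
      ring
    have hsq : ∑ p : Equiv.Perm (Fin n) × Equiv.Perm (Fin n), (T p.1 + T p.2) ^ 2
        = 2 * M * ∑ σ, T σ ^ 2 := by
      simp only [add_sq, Fintype.sum_prod_type, Finset.sum_add_distrib, Finset.sum_const,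
        Finset.card_univ, nsmul_eq_mul, ← Finset.mul_sum, hT0, ← hM, mul_zero]
      ring
    rw [hVar, hmean]
    simp only [hS, add_sub_cancel_right]
    rw [hsq, hT2, hNM, hV2]
    field_simp
  rw [Finset.sum_congr rfl hvar, ← Finset.mul_sum, sum_parabola]
  field_simp
  ring
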